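/- Let 0<ρ<1, μ∈ℂ, α>0, and let (λ_k) be a nondecreasing sequence of positive reals with λ_k→∞ and λ_k≠α² for all k. Then there exists a constant C₆>0 such that for every t>0, every square-summable complex sequence (g_k), and each choice of sign ∓, one has ∑_k (λ_k²/|α²−λ_k|) |E_{ρ,μ}(−(α∓√(α²−λ_k)) t^ρ)|² |g_k|² ≤ C₆ t^{−2ρ} ∑_k |g_k|². -/

import Mathlib

open Filter

/-- The two-parameter Mittag-Leffler function. -/
noncomputable def mlE (ρ : ℝ) (μ : ℂ) (z : ℂ) : ℂ :=
  ∑' k : ℕ, z ^ k / Complex.Gamma (((ρ * k : ℝ) : ℂ) + μ)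

/-- The principal complex square root of `α² - λ`. -/
noncomputable def sqrtD (α lam : ℝ) : ℂ := ((α ^ 2 - lam : ℝ) : ℂ) ^ ((1:ℂ)/2)

open MeasureTheory Complex Set Topology

/-! ### The reciprocal Gamma function as an integral over a vertical line -/

lemma norm_cpow_mul_exp_neg_mul {t : ℝ} (ht : 0 < t) (a r : ℂ) :
    ‖(t : ℂ) ^ a * cexp (-(r * t))‖ = t ^ a.re * Real.exp (-r.re * t ^ (1 : ℝ)) := by
  rw [norm_mul, norm_cpow_eq_rpow_re_of_pos ht, Complex.norm_exp]
  simp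

lemma aestronglyMeasurable_cpow_mul_exp_neg_mul (a r : ℂ) :
    AEStronglyMeasurable (fun t : ℝ => (t : ℂ) ^ a * cexp (-(r * t)))
      (volume.restrict (Ioi 0)) := by
  refine ContinuousOn.aestronglyMeasurable (fun t ht => ?_) measurableSet_Ioi
  refine ContinuousAt.continuousWithinAt ?_
  exact (continuousAt_ofReal_cpow_const t a (Or.inr (ne_of_gt ht))).mul (by fun_prop)

lemma integrableOn_cpow_mul_exp_neg_mul {a r : ℂ} (ha : -1 < a.re) (hr : 0 < r.re) :
    IntegrableOn (fun t : ℝ => (t : ℂ) ^ a * cexp (-(r * t))) (Ioi 0) := by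
  refine (integrableOn_rpow_mul_exp_neg_mul_rpow ha one_pos hr).mono'
    (aestronglyMeasurable_cpow_mul_exp_neg_mul a r) ?_
  filter_upwards [ae_restrict_mem measurableSet_Ioi] with t ht
  exact (norm_cpow_mul_exp_neg_mul ht a r).le

lemma differentiableAt_integral_cpow_mul_exp_neg_mul {a r : ℂ} (ha : -1 < a.re) (hr : 0 < r.re) :
    DifferentiableAt ℂ
      (fun r : ℂ => ∫ t : ℝ in Ioi 0, (t : ℂ) ^ a * cexp (-(r * t))) r := by
  have hs : {w : ℂ | r.re / 2 < w.re} ∈ 𝓝 r :=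
    (isOpen_lt continuous_const continuous_re).mem_nhds (by simpa using hr)
  refine (hasDerivAt_integral_of_dominated_loc_of_deriv_le
    (F' := fun w (t : ℝ) => (t : ℂ) ^ a * (cexp (-(w * t)) * (-t)))
    (bound := fun t : ℝ => t ^ (a.re + 1) * Real.exp (-(r.re / 2) * t ^ (1 : ℝ))) hs
    (Eventually.of_forall fun w => aestronglyMeasurable_cpow_mul_exp_neg_mul a w)
    (integrableOn_cpow_mul_exp_neg_mul ha hr) ?_ ?_ ?_ ?_).2.differentiableAt
  · have := (aestronglyMeasurable_cpow_mul_exp_neg_mul a r).mul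
      (Continuous.aestronglyMeasurable (f := fun t : ℝ => -(t : ℂ)) (by fun_prop))
    refine this.congr (Eventually.of_forall fun t => ?_)
    simp [mul_assoc]
  · filter_upwards [ae_restrict_mem measurableSet_Ioi] with t ht w hw
    have ht' : (0 : ℝ) < t := ht
    rw [← mul_assoc, norm_mul, norm_cpow_mul_exp_neg_mul ht', Real.rpow_add ht']
    simp only [norm_neg, norm_real, Real.norm_of_nonneg ht'.le, Real.rpow_one]
    have : Real.exp (-w.re * t) ≤ Real.exp (-(r.re / 2) * t) := by
      apply Real.exp_le_exp.2
      have : r.re / 2 < w.re := hw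
      nlinarith
    have h0 : 0 ≤ t ^ a.re * t := by positivity
    nlinarith
  · exact integrableOn_rpow_mul_exp_neg_mul_rpow (by linarith) one_pos (by linarith)
  · filter_upwards with t w _
    have h : HasDerivAt (fun w : ℂ => -(w * (t : ℂ))) (-(t : ℂ)) w := by
      simpa using ((hasDerivAt_id' w).mul_const (t : ℂ)).fun_neg
    exact h.cexp.const_mul _

lemma integral_cpow_mul_exp_neg_mul_complex {a r : ℂ} (ha : 0 < a.re) (hr : 0 < r.re) :
    ∫ t : ℝ in Ioi 0, (t : ℂ) ^ (a - 1) * cexp (-(r * t)) = r ^ (-a) * Gamma a := by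
  let U : Set ℂ := {w | 0 < w.re}
  have hU : IsOpen U := isOpen_lt continuous_const continuous_re
  have hUc : IsPreconnected U := (convex_halfSpace_re_gt 0).isPreconnected
  have h1 : AnalyticOnNhd ℂ
      (fun r : ℂ => ∫ t : ℝ in Ioi 0, (t : ℂ) ^ (a - 1) * cexp (-(r * t))) U :=
    DifferentiableOn.analyticOnNhd (fun w hw =>
      (differentiableAt_integral_cpow_mul_exp_neg_mul (by simpa using ha)
        hw).differentiableWithinAt) hU
  have h2 : AnalyticOnNhd ℂ (fun r : ℂ => r ^ (-a) * Gamma a) U :=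
    DifferentiableOn.analyticOnNhd (fun w hw =>
      ((differentiableAt_id.cpow_const (Or.inl hw)).mul_const _).differentiableWithinAt) hU
  refine h1.eqOn_of_preconnected_of_frequently_eq h2 hUc (z₀ := 1) (by simp [U]) ?_ hr
  have hreal : ∀ x : ℝ, 0 < x →
      (∫ t : ℝ in Ioi 0, (t : ℂ) ^ (a - 1) * cexp (-((x : ℂ) * t))) =
        (x : ℂ) ^ (-a) * Gamma a := fun x hx => by
    rw [integral_cpow_mul_exp_neg_mul_Ioi ha hx, one_div, cpow_neg,
      inv_cpow _ _ (by simpa [arg_ofReal_of_nonneg hx.le] using Real.pi_ne_zero.symm)]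
  have ht : Tendsto (fun n : ℕ => ((1 + 1 / ((n : ℝ) + 1) : ℝ) : ℂ)) atTop (𝓝[≠] 1) := by
    refine tendsto_nhdsWithin_iff.2 ⟨?_, Eventually.of_forall fun n => ?_⟩
    · have := (tendsto_one_div_add_atTop_nhds_zero_nat (𝕜 := ℝ)).const_add 1
      have h := (continuous_ofReal.tendsto _).comp this
      simpa [Function.comp_def] using h
    · have : (0 : ℝ) < 1 / ((n : ℝ) + 1) := by positivity
      intro h
      have h' : (1 + 1 / ((n : ℝ) + 1) : ℝ) = 1 := ofReal_injective (by simpa using h)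
      linarith
  exact ht.frequently (Eventually.of_forall fun n => hreal _ (by positivity)).frequently

/-- The vertical line through `c`, parametrised so that `fourier` applies directly. -/
noncomputable def vline (c ξ : ℝ) : ℂ := c + 2 * Real.pi * ξ * I

@[simp] lemma vline_re (c ξ : ℝ) : (vline c ξ).re = c := by simp [vline]

@[simp] lemma vline_im (c ξ : ℝ) : (vline c ξ).im = 2 * Real.pi * ξ := by simp [vline]

lemma continuous_vline (c : ℝ) : Continuous (vline c) := by unfold vline; fun_prop

lemma vline_ne_zero {c : ℝ} (hc : 0 < c) (ξ : ℝ) : vline c ξ ≠ 0 := fun h => by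
  have := congrArg re h
  simp at this
  exact hc.ne' this

lemma le_norm_vline (c ξ : ℝ) : c ≤ ‖vline c ξ‖ := by
  simpa using re_le_norm (vline c ξ)

lemma one_add_sq_le_norm_vline_sq {c : ℝ} (hc : 1 ≤ c) (ξ : ℝ) :
    1 + ξ ^ 2 ≤ ‖vline c ξ‖ ^ 2 := by
  rw [← normSq_eq_norm_sq, normSq_apply, vline_re, vline_im]
  have := Real.pi_gt_three
  have h : ξ ^ 2 ≤ (Real.pi * ξ) ^ 2 := by
    rw [mul_pow]
    exact le_mul_of_one_le_left (sq_nonneg ξ) (by nlinarith)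
  nlinarith [sq_nonneg (Real.pi * ξ)]

lemma norm_vline_cpow_neg_le {c : ℝ} (hc : 1 ≤ c) {s : ℂ} (hs : 2 ≤ s.re) (ξ : ℝ) :
    ‖vline c ξ ^ (-s)‖ ≤ Real.exp (Real.pi * |s.im|) * c ^ (2 - s.re) * (1 + ξ ^ 2)⁻¹ := by
  have h0 : 0 < ‖vline c ξ‖ := (by linarith : 0 < c).trans_le (le_norm_vline c ξ)
  rw [norm_cpow_of_ne_zero (norm_pos_iff.1 h0), div_eq_mul_inv, ← Real.exp_neg]
  have h1 : Real.exp (-(arg (vline c ξ) * (-s).im)) ≤ Real.exp (Real.pi * |s.im|) := by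
    apply Real.exp_le_exp.2
    calc -(arg (vline c ξ) * (-s).im) ≤ |arg (vline c ξ) * s.im| := by
          simpa using le_abs_self (arg (vline c ξ) * s.im)
      _ ≤ _ := by
          rw [abs_mul]
          exact mul_le_mul_of_nonneg_right (abs_arg_le_pi _) (abs_nonneg _)
  have h2 : ‖vline c ξ‖ ^ (-s).re ≤ c ^ (2 - s.re) * (1 + ξ ^ 2)⁻¹ := by
    have : (-s).re = (2 - s.re) + (-2 : ℝ) := by simp; ring
    rw [this, Real.rpow_add h0]
    refine mul_le_mul (Real.rpow_le_rpow_of_nonpos (by linarith) (le_norm_vline c ξ)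
      (by linarith)) ?_ (by positivity) (by positivity)
    rw [Real.rpow_neg h0.le, show (2 : ℝ) = (2 : ℕ) by norm_num, Real.rpow_natCast]
    exact inv_anti₀ (by positivity) (one_add_sq_le_norm_vline_sq hc ξ)
  calc _ ≤ (c ^ (2 - s.re) * (1 + ξ ^ 2)⁻¹) * Real.exp (Real.pi * |s.im|) :=
        mul_le_mul h2 h1 (by positivity) (by positivity)
    _ = _ := by ring

lemma continuous_vline_cpow {c : ℝ} (hc : 0 < c) (s : ℂ) :
    Continuous fun ξ => vline c ξ ^ s :=
  (continuous_vline c).cpow continuous_const fun ξ => Or.inl (by simpa using hc)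

lemma integrable_vline_cpow_neg {c : ℝ} (hc : 1 ≤ c) {s : ℂ} (hs : 2 ≤ s.re) :
    Integrable fun ξ => vline c ξ ^ (-s) :=
  (integrable_inv_one_add_sq.const_mul _).mono'
    (continuous_vline_cpow (by linarith) _).aestronglyMeasurable
    (Eventually.of_forall fun ξ => norm_vline_cpow_neg_le hc hs ξ)

open FourierTransform in
/-- Laplace's formula for the reciprocal Gamma function. -/
lemma integral_exp_mul_vline_cpow_neg {c : ℝ} (hc : 1 ≤ c) {s : ℂ} (hs : 2 ≤ s.re) :
    ∫ ξ, cexp (vline c ξ) * vline c ξ ^ (-s) = (Gamma s)⁻¹ := by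
  let f : ℝ → ℂ := indicator (Ioi 0) fun t => (t : ℂ) ^ (s - 1) * cexp (-((c : ℂ) * t))
  have hc0 : 0 < c := by linarith
  have hs0 : 0 < s.re := by linarith
  have hG : Gamma s ≠ 0 := Gamma_ne_zero_of_re_pos hs0
  have hf : Integrable f :=
    (integrable_indicator_iff measurableSet_Ioi).2
      (integrableOn_cpow_mul_exp_neg_mul (by simp; linarith) (by simpa using hc0))
  have hF : 𝓕 f = fun ξ => vline c ξ ^ (-s) * Gamma s := by
    ext ξ
    rw [Real.fourier_real_eq_integral_exp_smul,
      ← integral_cpow_mul_exp_neg_mul_complex hs0 (r := vline c ξ) (by simpa using hc0),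
      ← integral_indicator measurableSet_Ioi]
    congr 1
    ext t
    by_cases ht : t ∈ Ioi (0 : ℝ)
    · simp only [f, indicator_of_mem ht, smul_eq_mul]
      rw [mul_left_comm, ← Complex.exp_add]
      congr 2
      simp [vline]
      ring
    · simp [f, indicator_of_notMem ht]
  have hFi : Integrable (𝓕 f) := by
    rw [hF]
    exact (integrable_vline_cpow_neg hc hs).mul_const _
  have hcont : ContinuousAt f 1 := by
    have h1 : ContinuousAt (fun t : ℝ => (t : ℂ) ^ (s - 1) * cexp (-((c : ℂ) * t))) 1 :=
      (continuousAt_ofReal_cpow_const 1 _ (Or.inr one_ne_zero)).mul (by fun_prop)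
    refine h1.congr ?_
    filter_upwards [Ioi_mem_nhds (zero_lt_one (α := ℝ))] with t ht
    simp only [f, indicator_of_mem ht]
  have key := hf.fourierInv_fourier_eq hFi hcont
  rw [hF, Real.fourierInv_eq'] at key
  have hone : f 1 = cexp (-c) := by
    simp [f]
  rw [hone] at key
  have : ∀ ξ, cexp (vline c ξ) * vline c ξ ^ (-s) = cexp c * (Gamma s)⁻¹ *
      (cexp (↑(2 * Real.pi * inner ℝ ξ (1 : ℝ)) * I) • (vline c ξ ^ (-s) * Gamma s)) := by
    intro ξ
    rw [show vline c ξ = c + 2 * Real.pi * ξ * I from rfl, Complex.exp_add]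
    simp
    field_simp
  simp_rw [this]
  rw [integral_const_mul, key, mul_right_comm, ← Complex.exp_add]
  simp

/-! ### Growth of the coefficients -/

lemma norm_inv_Gamma_le {c : ℝ} (hc : 1 ≤ c) {s : ℂ} (hs : 2 ≤ s.re) :
    ‖(Gamma s)⁻¹‖ ≤ Real.exp (c + Real.pi * |s.im|) * Real.pi * c ^ (2 - s.re) := by
  rw [← integral_exp_mul_vline_cpow_neg hc hs]
  refine (norm_integral_le_of_norm_le (integrable_inv_one_add_sq.const_mul
    (Real.exp c * (Real.exp (Real.pi * |s.im|) * c ^ (2 - s.re))))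
    (Eventually.of_forall fun ξ => ?_)).trans (le_of_eq ?_)
  · rw [norm_mul, Complex.norm_exp, vline_re, mul_assoc]
    exact mul_le_mul_of_nonneg_left (norm_vline_cpow_neg_le hc hs ξ) (Real.exp_pos _).le
  · rw [integral_const_mul, integral_univ_inv_one_add_sq, Real.exp_add]
    ring

lemma exists_norm_inv_Gamma_mul_pow_le {ρ : ℝ} (hρ : 0 < ρ) (μ : ℂ) {R : ℝ} (hR : 1 ≤ R) :
    ∃ K, ∀ k : ℕ, ‖(Gamma (((ρ * k : ℝ) : ℂ) + μ))⁻¹‖ * R ^ k ≤ K := by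
  have hlin : Tendsto (fun k : ℕ => ρ * (k : ℝ) + μ.re) atTop atTop :=
    tendsto_atTop_add_const_right _ _ (tendsto_natCast_atTop_atTop.const_mul_atTop hρ)
  obtain ⟨c, hc⟩ : ∃ c : ℝ, c = R ^ ρ⁻¹ := ⟨_, rfl⟩
  have hc1 : 1 ≤ c := hc ▸ Real.one_le_rpow hR (inv_pos.2 hρ).le
  have hcR : c ^ ρ = R := by
    rw [hc, ← Real.rpow_mul (by linarith), inv_mul_cancel₀ hρ.ne', Real.rpow_one]
  have hbdd : BddAbove (range fun k : ℕ => ‖(Gamma (((ρ * k : ℝ) : ℂ) + μ))⁻¹‖ * R ^ k) := by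
    refine Filter.IsBoundedUnder.bddAbove_range
      ⟨Real.exp (c + Real.pi * |μ.im|) * Real.pi * c ^ (2 - μ.re), ?_⟩
    rw [eventually_map]
    filter_upwards [hlin.eventually_ge_atTop 2] with k hk
    have h := norm_inv_Gamma_le hc1 (s := ((ρ * k : ℝ) : ℂ) + μ) (by simpa using hk)
    have hpow : c ^ (2 - (((ρ * k : ℝ) : ℂ) + μ).re) * R ^ k = c ^ (2 - μ.re) := by
      rw [← hcR, ← Real.rpow_natCast, ← Real.rpow_mul (by linarith),
        ← Real.rpow_add (by linarith)]
      congr 1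
      simp
      ring
    calc _ ≤ _ := mul_le_mul_of_nonneg_right h (by positivity)
      _ = _ := by rw [mul_assoc, hpow]; simp
  obtain ⟨K, hK⟩ := hbdd
  exact ⟨K, fun k => hK ⟨k, rfl⟩⟩

/-! ### The Mittag-Leffler series -/

lemma exists_summable_bound_mlE_term {ρ : ℝ} (hρ : 0 < ρ) (μ : ℂ) {R : ℝ} (hR : 1 ≤ R) :
    ∃ u : ℕ → ℝ, Summable u ∧ ∀ k : ℕ, ∀ w ∈ Metric.ball (0 : ℂ) R,
      ‖w ^ k / Gamma (((ρ * k : ℝ) : ℂ) + μ)‖ ≤ u k := by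
  obtain ⟨K, hK⟩ := exists_norm_inv_Gamma_mul_pow_le hρ μ (R := 2 * R) (by linarith)
  refine ⟨fun k => K * (1 / 2) ^ k, summable_geometric_two.mul_left K, fun k w hw => ?_⟩
  have hw' : ‖w‖ ≤ R := (mem_ball_zero_iff.1 hw).le
  rw [div_eq_mul_inv, norm_mul, norm_pow]
  calc ‖w‖ ^ k * ‖(Gamma (((ρ * k : ℝ) : ℂ) + μ))⁻¹‖
      ≤ R ^ k * ‖(Gamma (((ρ * k : ℝ) : ℂ) + μ))⁻¹‖ := by gcongr
    _ = ‖(Gamma (((ρ * k : ℝ) : ℂ) + μ))⁻¹‖ * (2 * R) ^ k * (1 / 2) ^ k := by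
        rw [mul_assoc, ← mul_pow, mul_comm]
        congr 2
        ring
    _ ≤ _ := mul_le_mul_of_nonneg_right (hK k) (by positivity)

lemma mem_ball_norm_add_one (z : ℂ) : z ∈ Metric.ball (0 : ℂ) (‖z‖ + 1) := by simp

lemma hasSum_mlE {ρ : ℝ} (hρ : 0 < ρ) (μ z : ℂ) :
    HasSum (fun k : ℕ => z ^ k / Gamma (((ρ * k : ℝ) : ℂ) + μ)) (mlE ρ μ z) := by
  obtain ⟨u, hu, hle⟩ := exists_summable_bound_mlE_term hρ μ (R := ‖z‖ + 1) (by simp)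
  exact (Summable.of_norm_bounded hu fun k => hle k z (mem_ball_norm_add_one z)).hasSum

lemma differentiable_mlE {ρ : ℝ} (hρ : 0 < ρ) (μ : ℂ) : Differentiable ℂ (mlE ρ μ) := by
  intro z
  obtain ⟨u, hu, hle⟩ := exists_summable_bound_mlE_term hρ μ (R := ‖z‖ + 1) (by simp)
  exact (differentiableOn_tsum_of_summable_norm hu (fun k => by fun_prop)
    Metric.isOpen_ball hle).differentiableAt
      (Metric.isOpen_ball.mem_nhds (mem_ball_norm_add_one z))

lemma mlE_sub_one {ρ : ℝ} (hρ : 0 < ρ) (μ z : ℂ) :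
    mlE ρ (μ - 1) z = (μ - 1) * mlE ρ μ z + ρ * (z * deriv (mlE ρ μ) z) := by
  obtain ⟨u, hu, hle⟩ := exists_summable_bound_mlE_term hρ μ (R := ‖z‖ + 1) (by simp)
  have hd := hasSum_deriv_of_summable_norm hu (fun k => by fun_prop)
    Metric.isOpen_ball hle (mem_ball_norm_add_one z)
  have h := ((hasSum_mlE hρ μ z).mul_left (μ - 1)).add ((hd.mul_left z).mul_left (ρ : ℂ))
  refine (hasSum_mlE hρ (μ - 1) z).unique (h.congr_fun fun k => ?_)
  have hG := one_div_Gamma_eq_self_mul_one_div_Gamma_add_one (((ρ * k : ℝ) : ℂ) + (μ - 1))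
  rw [show ((ρ * k : ℝ) : ℂ) + (μ - 1) + 1 = ((ρ * k : ℝ) : ℂ) + μ by ring] at hG
  have hder : z * deriv (fun w : ℂ => w ^ k / Gamma (((ρ * k : ℝ) : ℂ) + μ)) z =
      k * z ^ k / Gamma (((ρ * k : ℝ) : ℂ) + μ) := by
    rw [deriv_div_const, deriv_pow_field]
    rcases k with _ | k
    · simp
    · rw [Nat.add_sub_cancel, pow_succ]
      ring
  rw [hder, div_eq_mul_inv, hG]
  push_cast
  ring

/-! ### Cauchy-type integrals -/

section CauchyIntegral

variable {w a : ℝ → ℂ} {δ : ℝ}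

lemma re_sub_le_norm_sub (x z : ℂ) : x.re - z.re ≤ ‖x - z‖ := by
  simpa using re_le_norm (x - z)

lemma integrable_mul_inv_sub_pow (hw : Integrable w) (ha : Continuous a)
    (hδ : ∀ ξ, δ ≤ (a ξ).re) (n : ℕ) {z : ℂ} (hz : z.re < δ) :
    Integrable fun ξ => w ξ * ((a ξ - z) ^ n)⁻¹ := by
  have hle : ∀ ξ, δ - z.re ≤ ‖a ξ - z‖ := fun ξ =>
    (by linarith [hδ ξ] : δ - z.re ≤ (a ξ).re - z.re).trans (re_sub_le_norm_sub _ _)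
  refine hw.mul_bdd (c := ((δ - z.re) ^ n)⁻¹) ?_ (Eventually.of_forall fun ξ => ?_)
  · refine Continuous.aestronglyMeasurable (Continuous.inv₀ (by fun_prop) fun ξ => ?_)
    exact pow_ne_zero _ (norm_pos_iff.1 ((by linarith : 0 < δ - z.re).trans_le (hle ξ)))
  · rw [norm_inv, norm_pow]
    have : 0 < δ - z.re := by linarith
    gcongr
    exact hle ξ

lemma hasDerivAt_integral_mul_inv_sub_pow (hw : Integrable w) (ha : Continuous a)
    (hδ : ∀ ξ, δ ≤ (a ξ).re) (n : ℕ) {z : ℂ} (hz : z.re < δ) :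
    HasDerivAt (fun z => ∫ ξ, w ξ * ((a ξ - z) ^ (n + 1))⁻¹)
      ((n + 1) * ∫ ξ, w ξ * ((a ξ - z) ^ (n + 2))⁻¹) z := by
  obtain ⟨ε, hε⟩ : ∃ ε, ε = (δ - z.re) / 2 := ⟨_, rfl⟩
  have hε0 : 0 < ε := by linarith
  have hs : {x : ℂ | x.re < δ - ε} ∈ 𝓝 z :=
    (isOpen_lt continuous_re continuous_const).mem_nhds (by simp; linarith)
  have hle : ∀ x : ℂ, x.re < δ - ε → ∀ ξ, ε ≤ ‖a ξ - x‖ := fun x hx ξ =>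
    (by linarith [hδ ξ] : ε ≤ (a ξ).re - x.re).trans (re_sub_le_norm_sub _ _)
  have hintegrable : ∀ m : ℕ, ∀ x : ℂ, x.re < δ - ε →
      Integrable fun ξ => w ξ * ((a ξ - x) ^ m)⁻¹ := fun m x hx =>
    integrable_mul_inv_sub_pow hw ha hδ m (by linarith)
  have hz' : z.re < δ - ε := by linarith
  have h := (hasDerivAt_integral_of_dominated_loc_of_deriv_le
    (F := fun x ξ => w ξ * ((a ξ - x) ^ (n + 1))⁻¹)
    (F' := fun x ξ => (n + 1 : ℂ) * (w ξ * ((a ξ - x) ^ (n + 2))⁻¹))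
    (bound := fun ξ => (n + 1) * (‖w ξ‖ * (ε ^ (n + 2))⁻¹)) hs
    (by filter_upwards [hs] with x hx using (hintegrable _ x hx).aestronglyMeasurable)
    (hintegrable _ z hz') ((hintegrable _ z hz').aestronglyMeasurable.const_mul _) ?_
    ((hw.norm.mul_const _).const_mul _) ?_).2
  · rwa [integral_const_mul] at h
  · refine Eventually.of_forall fun ξ x hx => ?_
    rw [norm_mul, norm_mul, norm_inv, norm_pow]
    have h1 : ‖(n + 1 : ℂ)‖ = n + 1 := by exact_mod_cast norm_natCast (n + 1)
    rw [h1]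
    gcongr
    exact hle x hx ξ
  · refine Eventually.of_forall fun ξ x hx => ?_
    have hne : a ξ - x ≠ 0 := norm_pos_iff.1 (hε0.trans_le (hle x hx ξ))
    have h1 : HasDerivAt (fun x => a ξ - x) (-1) x := by
      simpa using (hasDerivAt_id' x).const_sub (a ξ)
    refine (((h1.fun_pow (n + 1)).fun_inv (pow_ne_zero _ hne)).const_mul (w ξ)).congr_deriv ?_
    simp only [Nat.add_sub_cancel, Nat.cast_add, Nat.cast_one]
    field_simp
    ring

lemma iteratedDeriv_eq_integral (hw : Integrable w) (ha : Continuous a)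
    (hδ : ∀ ξ, δ ≤ (a ξ).re) {f : ℂ → ℂ}
    (hf : ∀ z : ℂ, z.re < δ → f z = ∫ ξ, w ξ * ((a ξ - z) ^ 1)⁻¹) (n : ℕ) :
    ∀ z : ℂ, z.re < δ →
      iteratedDeriv n f z = (n.factorial : ℂ) * ∫ ξ, w ξ * ((a ξ - z) ^ (n + 1))⁻¹ := by
  induction n with
  | zero => simpa using hf
  | succ n ih =>
    intro z hz
    have hev : iteratedDeriv n f =ᶠ[𝓝 z]
        fun z => (n.factorial : ℂ) * ∫ ξ, w ξ * ((a ξ - z) ^ (n + 1))⁻¹ := by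
      filter_upwards [(isOpen_lt continuous_re continuous_const).mem_nhds hz] with x hx
        using ih x hx
    rw [iteratedDeriv_succ, hev.deriv_eq,
      ((hasDerivAt_integral_mul_inv_sub_pow hw ha hδ n hz).const_mul _).deriv,
      Nat.factorial_succ]
    push_cast
    ring

lemma norm_pow_mul_norm_integral_le (hw : Integrable w) (hδ0 : 0 < δ)
    (hδa : ∀ ξ, δ * ‖a ξ‖ ≤ (a ξ).re) (n : ℕ) {z : ℂ} (hz : z.re < 0) :
    ‖z‖ ^ n * ‖∫ ξ, w ξ * ((a ξ - z) ^ n)⁻¹‖ ≤ (1 + δ⁻¹) ^ n * ∫ ξ, ‖w ξ‖ := by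
  have hz0 : 0 < ‖z‖ := norm_pos_iff.2 fun h => by simp [h] at hz
  have hle : ∀ ξ, ‖z‖ ≤ (1 + δ⁻¹) * ‖a ξ - z‖ := fun ξ => by
    have h1 : δ * ‖a ξ‖ ≤ ‖a ξ - z‖ := by
      linarith [hδa ξ, re_sub_le_norm_sub (a ξ) z]
    have h2 : ‖a ξ‖ ≤ δ⁻¹ * ‖a ξ - z‖ := (le_inv_mul_iff₀ hδ0).2 h1
    have h3 : ‖z‖ ≤ ‖a ξ‖ + ‖a ξ - z‖ := by
      simpa using norm_sub_le (a ξ) (a ξ - z)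
    linarith
  rw [← integral_const_mul, ← norm_pow, ← norm_mul, ← integral_const_mul]
  refine norm_integral_le_of_norm_le (hw.norm.const_mul _) (Eventually.of_forall fun ξ => ?_)
  have hpos : 0 < ‖a ξ - z‖ := by
    by_contra h
    have h0 : ‖a ξ - z‖ = 0 := le_antisymm (not_lt.1 h) (norm_nonneg _)
    have := hle ξ
    rw [h0] at this
    linarith
  rw [norm_mul, norm_mul, norm_inv, norm_pow, norm_pow]
  calc ‖z‖ ^ n * (‖w ξ‖ * (‖a ξ - z‖ ^ n)⁻¹)
      ≤ ((1 + δ⁻¹) * ‖a ξ - z‖) ^ n * (‖w ξ‖ * (‖a ξ - z‖ ^ n)⁻¹) := by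
        gcongr
        exact hle ξ
    _ = (1 + δ⁻¹) ^ n * ‖w ξ‖ := by
        rw [mul_pow]
        field_simp

end CauchyIntegral

/-! ### Integral representation and decay in the left half-plane -/

lemma cos_mul_norm_le_re_vline_cpow {ρ : ℝ} (hρ0 : 0 < ρ) (hρ1 : ρ < 1) (ξ : ℝ) :
    Real.cos (Real.pi / 2 * ρ) * ‖vline 1 ξ ^ (ρ : ℂ)‖ ≤ (vline 1 ξ ^ (ρ : ℂ)).re := by
  have harg : |arg (vline 1 ξ)| ≤ Real.pi / 2 :=
    abs_arg_le_pi_div_two_iff.2 (by simp)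
  have hcos : Real.cos (Real.pi / 2 * ρ) ≤ Real.cos (arg (vline 1 ξ) * ρ) := by
    rw [← Real.cos_abs (arg (vline 1 ξ) * ρ), abs_mul, abs_of_pos hρ0]
    refine Real.cos_le_cos_of_nonneg_of_le_pi (by positivity) ?_ (by gcongr)
    nlinarith [Real.pi_pos]
  rw [cpow_ofReal_re, norm_cpow_real, mul_comm]
  exact mul_le_mul_of_nonneg_left hcos (by positivity)

lemma one_le_norm_vline_cpow {ρ : ℝ} (hρ0 : 0 < ρ) (ξ : ℝ) :
    1 ≤ ‖vline 1 ξ ^ (ρ : ℂ)‖ := by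
  rw [norm_cpow_real]
  exact Real.one_le_rpow (le_norm_vline 1 ξ) hρ0.le

lemma cos_pi_div_two_mul_pos {ρ : ℝ} (hρ0 : 0 < ρ) (hρ1 : ρ < 1) :
    0 < Real.cos (Real.pi / 2 * ρ) :=
  Real.cos_pos_of_mem_Ioo ⟨by nlinarith [Real.pi_pos], by nlinarith [Real.pi_pos]⟩

lemma cos_le_re_vline_cpow {ρ : ℝ} (hρ0 : 0 < ρ) (hρ1 : ρ < 1) (ξ : ℝ) :
    Real.cos (Real.pi / 2 * ρ) ≤ (vline 1 ξ ^ (ρ : ℂ)).re :=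
  (le_mul_of_one_le_right (cos_pi_div_two_mul_pos hρ0 hρ1).le
    (one_le_norm_vline_cpow hρ0 ξ)).trans (cos_mul_norm_le_re_vline_cpow hρ0 hρ1 ξ)

lemma integrable_exp_mul_vline_cpow_neg {s : ℂ} (hs : 2 ≤ s.re) :
    Integrable fun ξ => cexp (vline 1 ξ) * vline 1 ξ ^ (-s) := by
  refine (integrable_vline_cpow_neg le_rfl hs).bdd_mul (c := Real.exp 1)
    (continuous_exp.comp (continuous_vline 1)).aestronglyMeasurable
    (Eventually.of_forall fun ξ => ?_)
  simp [Complex.norm_exp]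

lemma mlE_eq_integral_of_norm_lt_one {ρ : ℝ} (hρ0 : 0 < ρ) {μ : ℂ}
    (hμ : 2 + ρ ≤ μ.re) {z : ℂ} (hz : ‖z‖ < 1) :
    mlE ρ μ z = ∫ ξ, cexp (vline 1 ξ) * vline 1 ξ ^ (-(μ - ρ)) *
      ((vline 1 ξ ^ (ρ : ℂ) - z) ^ 1)⁻¹ := by
  let F : ℕ → ℝ → ℂ := fun k ξ =>
    cexp (vline 1 ξ) * vline 1 ξ ^ (-μ) * (z / vline 1 ξ ^ (ρ : ℂ)) ^ k
  have hμ2 : 2 ≤ μ.re := by linarith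
  have hFeq : ∀ k ξ, F k ξ =
      z ^ k * (cexp (vline 1 ξ) * vline 1 ξ ^ (-(((ρ * k : ℝ) : ℂ) + μ))) := fun k ξ => by
    have h0 := vline_ne_zero one_pos ξ
    have hk : vline 1 ξ ^ (-((ρ * k : ℝ) : ℂ)) = ((vline 1 ξ ^ (ρ : ℂ)) ^ k)⁻¹ := by
      rw [cpow_neg, ← cpow_nat_mul]
      congr 2
      push_cast
      ring
    simp only [F]
    rw [neg_add, cpow_add _ _ h0, hk, div_pow]
    ring
  have hre : ∀ k : ℕ, 2 ≤ (((ρ * k : ℝ) : ℂ) + μ).re := fun k => by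
    have : 0 ≤ ρ * (k : ℝ) := by positivity
    simp
    linarith
  have hFint : ∀ k, Integrable (F k) := fun k => by
    simp_rw [funext (hFeq k)]
    exact (integrable_exp_mul_vline_cpow_neg (hre k)).const_mul _
  have hratio : ∀ ξ, ‖z / vline 1 ξ ^ (ρ : ℂ)‖ ≤ ‖z‖ := fun ξ => by
    rw [norm_div]
    exact div_le_self (norm_nonneg _) (one_le_norm_vline_cpow hρ0 ξ)
  have hsum : Summable fun k => ∫ ξ, ‖F k ξ‖ := by
    refine Summable.of_nonneg_of_le (fun k => integral_nonneg fun ξ => norm_nonneg _)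
      (fun k => ?_) ((summable_geometric_of_lt_one (norm_nonneg z) hz).mul_right
        (∫ ξ, ‖cexp (vline 1 ξ) * vline 1 ξ ^ (-μ)‖))
    rw [← integral_const_mul]
    refine integral_mono (hFint k).norm
      ((integrable_exp_mul_vline_cpow_neg hμ2).norm.const_mul _) fun ξ => ?_
    simp only [F]
    rw [norm_mul, norm_pow, mul_comm]
    gcongr
    exact hratio ξ
  have h := hasSum_integral_of_summable_integral_norm hFint hsum
  have hval : ∀ k, ∫ ξ, F k ξ = z ^ k / Gamma (((ρ * k : ℝ) : ℂ) + μ) := fun k => by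
    simp_rw [hFeq k]
    rw [integral_const_mul, integral_exp_mul_vline_cpow_neg le_rfl (hre k), div_eq_mul_inv]
  simp_rw [hval] at h
  rw [(hasSum_mlE hρ0 μ z).unique h]
  congr 1
  ext ξ
  have h0 := vline_ne_zero one_pos ξ
  have ha0 : vline 1 ξ ^ (ρ : ℂ) ≠ 0 :=
    norm_pos_iff.1 (one_pos.trans_le (one_le_norm_vline_cpow hρ0 ξ))
  simp only [F]
  rw [tsum_mul_left, tsum_geometric_of_norm_lt_one ((hratio ξ).trans_lt hz),
    show -(μ - ρ) = -μ + ρ by ring, cpow_add _ _ h0, one_sub_div ha0, inv_div, pow_one]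
  ring

lemma mlE_eq_integral {ρ : ℝ} (hρ0 : 0 < ρ) (hρ1 : ρ < 1) {μ : ℂ} (hμ : 2 + ρ ≤ μ.re) {z : ℂ}
    (hz : z.re < Real.cos (Real.pi / 2 * ρ)) :
    mlE ρ μ z = ∫ ξ, cexp (vline 1 ξ) * vline 1 ξ ^ (-(μ - ρ)) *
      ((vline 1 ξ ^ (ρ : ℂ) - z) ^ 1)⁻¹ := by
  let U : Set ℂ := {z | z.re < Real.cos (Real.pi / 2 * ρ)}
  have hU : IsOpen U := isOpen_lt continuous_re continuous_const
  have h1 : AnalyticOnNhd ℂ (mlE ρ μ) U :=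
    (differentiable_mlE hρ0 μ).differentiableOn.analyticOnNhd hU
  have h2 : AnalyticOnNhd ℂ (fun z => ∫ ξ, cexp (vline 1 ξ) * vline 1 ξ ^ (-(μ - ρ)) *
      ((vline 1 ξ ^ (ρ : ℂ) - z) ^ 1)⁻¹) U :=
    DifferentiableOn.analyticOnNhd (fun w hw =>
      (hasDerivAt_integral_mul_inv_sub_pow
        (integrable_exp_mul_vline_cpow_neg (by simp; linarith))
        (continuous_vline_cpow one_pos _) (cos_le_re_vline_cpow hρ0 hρ1) 0
        hw).differentiableAt.differentiableWithinAt) hU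
  refine h1.eqOn_of_preconnected_of_eventuallyEq h2 (convex_halfSpace_re_lt _).isPreconnected
    (z₀ := 0) (by simpa [U] using cos_pi_div_two_mul_pos hρ0 hρ1) ?_ hz
  filter_upwards [Metric.ball_mem_nhds (0 : ℂ) one_pos] with w hw
  exact mlE_eq_integral_of_norm_lt_one hρ0 hμ (mem_ball_zero_iff.1 hw)

lemma exists_norm_iteratedDeriv_mlE_le_of_re {ρ : ℝ} (hρ0 : 0 < ρ) (hρ1 : ρ < 1) {μ : ℂ}
    (hμ : 2 + ρ ≤ μ.re) (n : ℕ) :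
    ∃ C, ∀ z : ℂ, z.re < 0 → ‖z‖ ^ (n + 1) * ‖iteratedDeriv n (mlE ρ μ) z‖ ≤ C := by
  have hpos := cos_pi_div_two_mul_pos hρ0 hρ1
  have hw : Integrable fun ξ => cexp (vline 1 ξ) * vline 1 ξ ^ (-(μ - ρ)) :=
    integrable_exp_mul_vline_cpow_neg (by simp; linarith)
  refine ⟨n.factorial * ((1 + (Real.cos (Real.pi / 2 * ρ))⁻¹) ^ (n + 1) *
    ∫ ξ, ‖cexp (vline 1 ξ) * vline 1 ξ ^ (-(μ - ρ))‖), fun z hz => ?_⟩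
  rw [iteratedDeriv_eq_integral hw (continuous_vline_cpow one_pos _)
    (cos_le_re_vline_cpow hρ0 hρ1) (fun z hz => mlE_eq_integral hρ0 hρ1 hμ hz) n z
    (hz.trans hpos), norm_mul, norm_natCast, mul_left_comm]
  exact mul_le_mul_of_nonneg_left (norm_pow_mul_norm_integral_le hw hpos
    (cos_mul_norm_le_re_vline_cpow hρ0 hρ1) (n + 1) hz) (by positivity)

lemma iteratedDeriv_id_mul_deriv {f : ℂ → ℂ} (hf : Differentiable ℂ f) (n : ℕ) :
    iteratedDeriv n (fun z => z * deriv f z) =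
      fun z => z * iteratedDeriv (n + 1) f z + n * iteratedDeriv n f z := by
  have hd : ∀ m, Differentiable ℂ (iteratedDeriv m f) := fun m =>
    (hf.contDiff (n := m + 1)).differentiable_iteratedDeriv m (by exact_mod_cast m.lt_succ_self)
  induction n with
  | zero => simp
  | succ n ih =>
    ext z
    have h1 := (hasDerivAt_id' z).fun_mul (hd (n + 1) z).hasDerivAt
    have h2 := ((hd n z).hasDerivAt).const_mul (n : ℂ)
    rw [iteratedDeriv_succ, ih, (h1.fun_add h2).deriv, ← iteratedDeriv_succ, ← iteratedDeriv_succ]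
    push_cast
    ring

lemma exists_norm_iteratedDeriv_mlE_sub_one_le {ρ : ℝ} (hρ0 : 0 < ρ) {μ : ℂ}
    (h : ∀ n : ℕ, ∃ C, ∀ z : ℂ, z.re < 0 →
      ‖z‖ ^ (n + 1) * ‖iteratedDeriv n (mlE ρ μ) z‖ ≤ C) (n : ℕ) :
    ∃ C, ∀ z : ℂ, z.re < 0 →
      ‖z‖ ^ (n + 1) * ‖iteratedDeriv n (mlE ρ (μ - 1)) z‖ ≤ C := by
  obtain ⟨A, hA⟩ := h n
  obtain ⟨B, hB⟩ := h (n + 1)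
  have hf := differentiable_mlE hρ0 μ
  have hcd' : ContDiff ℂ n fun z => z * deriv (mlE ρ μ) z :=
    contDiff_id.mul hf.deriv.contDiff
  have heq : mlE ρ (μ - 1) =
      (fun z => (μ - 1) * mlE ρ μ z) + fun z => ρ * (z * deriv (mlE ρ μ) z) :=
    funext fun z => mlE_sub_one hρ0 μ z
  refine ⟨‖μ - 1‖ * A + ρ * (B + n * A), fun z hz => ?_⟩
  have hcd1 : ContDiff ℂ n (mlE ρ μ) := hf.contDiff
  rw [heq, iteratedDeriv_add (contDiff_const.mul hcd1).contDiffAt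
    (contDiff_const.mul hcd').contDiffAt, iteratedDeriv_const_mul _ hcd1.contDiffAt,
    iteratedDeriv_const_mul _ hcd'.contDiffAt, iteratedDeriv_id_mul_deriv hf]
  calc _ ≤ ‖z‖ ^ (n + 1) * (‖μ - 1‖ * ‖iteratedDeriv n (mlE ρ μ) z‖ +
        ρ * (‖z‖ * ‖iteratedDeriv (n + 1) (mlE ρ μ) z‖ +
          n * ‖iteratedDeriv n (mlE ρ μ) z‖)) := by
        gcongr
        refine (norm_add_le _ _).trans ?_
        rw [norm_mul, norm_mul, norm_real, Real.norm_of_nonneg hρ0.le]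
        gcongr
        refine (norm_add_le _ _).trans ?_
        rw [norm_mul, norm_mul, norm_natCast]
    _ = ‖μ - 1‖ * (‖z‖ ^ (n + 1) * ‖iteratedDeriv n (mlE ρ μ) z‖) +
        ρ * (‖z‖ ^ (n + 1 + 1) * ‖iteratedDeriv (n + 1) (mlE ρ μ) z‖ +
          n * (‖z‖ ^ (n + 1) * ‖iteratedDeriv n (mlE ρ μ) z‖)) := by ring
    _ ≤ _ := by
        gcongr
        · exact hA z hz
        · exact hB z hz
        · exact hA z hz

lemma exists_norm_iteratedDeriv_mlE_le {ρ : ℝ} (hρ0 : 0 < ρ) (hρ1 : ρ < 1) (m : ℕ) :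
    ∀ μ : ℂ, 2 + ρ ≤ μ.re + m → ∀ n : ℕ, ∃ C, ∀ z : ℂ, z.re < 0 →
      ‖z‖ ^ (n + 1) * ‖iteratedDeriv n (mlE ρ μ) z‖ ≤ C := by
  induction m with
  | zero => exact fun μ hμ => exists_norm_iteratedDeriv_mlE_le_of_re hρ0 hρ1 (by simpa using hμ)
  | succ m ih =>
    intro μ hμ
    have h := exists_norm_iteratedDeriv_mlE_sub_one_le hρ0
      (ih (μ + 1) (by push_cast at hμ; simp; linarith))
    simpa using h

/-- The Mittag-Leffler function with `0 < ρ < 1` decays like `1 / ‖z‖` in the left half-plane. -/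
lemma exists_norm_mul_norm_mlE_le {ρ : ℝ} (hρ0 : 0 < ρ) (hρ1 : ρ < 1) (μ : ℂ) :
    ∃ C, ∀ z : ℂ, z.re < 0 → ‖z‖ * ‖mlE ρ μ z‖ ≤ C := by
  obtain ⟨m, hm⟩ := exists_nat_ge (2 + ρ - μ.re)
  simpa using exists_norm_iteratedDeriv_mlE_le hρ0 hρ1 m μ (by linarith) 0

/-! ### The roots `α ± √(α² - λ)` -/

lemma sqrtD_sq (α lam : ℝ) : sqrtD α lam ^ 2 = ((α ^ 2 - lam : ℝ) : ℂ) := by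
  rw [sqrtD, ← cpow_nat_mul]
  norm_num

lemma norm_sqrtD_sq (α lam : ℝ) : ‖sqrtD α lam‖ ^ 2 = |α ^ 2 - lam| := by
  rw [← norm_pow, sqrtD_sq, norm_real, Real.norm_eq_abs]

lemma abs_re_sqrtD_lt {α lam : ℝ} (hα : 0 < α) (hlam : 0 < lam) : |(sqrtD α lam).re| < α := by
  have h := sqrtD_sq α lam
  have hre := congrArg re h
  have him := congrArg im h
  simp only [sq, mul_re, mul_im, ofReal_re, ofReal_im] at hre him
  have h0 : (sqrtD α lam).re * (sqrtD α lam).im = 0 := by linarith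
  refine abs_lt_of_sq_lt_sq ?_ hα.le
  rcases mul_eq_zero.1 h0 with h0 | h0
  · rw [h0, zero_pow two_ne_zero]
    positivity
  · rw [h0] at hre; nlinarith

lemma re_add_mul_sqrtD_pos {α lam : ℝ} (hα : 0 < α) (hlam : 0 < lam) {σ : ℂ}
    (hσ : σ = 1 ∨ σ = -1) : 0 < ((α : ℂ) + σ * sqrtD α lam).re := by
  have h := abs_lt.1 (abs_re_sqrtD_lt hα hlam)
  rcases hσ with rfl | rfl <;> simp <;> linarith [h.1, h.2]

lemma weight_le {α lam : ℝ} (hlam : 0 < lam) (hne : lam ≠ α ^ 2) {σ : ℂ}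
    (hσ : σ = 1 ∨ σ = -1) :
    lam ^ 2 / |α ^ 2 - lam| ≤
      (2 * α ^ 2 / |α ^ 2 - lam| + 2) * ‖(α : ℂ) + σ * sqrtD α lam‖ ^ 2 := by
  have hpos : 0 < |α ^ 2 - lam| := abs_pos.2 (sub_ne_zero.2 hne.symm)
  have hσ2 : σ ^ 2 = 1 := by rcases hσ with rfl | rfl <;> norm_num
  have hσn : ‖σ‖ = 1 := by rcases hσ with rfl | rfl <;> simp
  have hprod : ((α : ℂ) - σ * sqrtD α lam) * ((α : ℂ) + σ * sqrtD α lam) = (lam : ℂ) := by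
    have := sqrtD_sq α lam
    push_cast at this
    linear_combination (-(sqrtD α lam) ^ 2) * hσ2 - this
  have hn := congrArg (fun x : ℂ => ‖x‖ ^ 2) hprod
  simp only [norm_mul, mul_pow, norm_real, Real.norm_of_nonneg hlam.le] at hn
  have hconj : ‖(α : ℂ) - σ * sqrtD α lam‖ ^ 2 ≤ 2 * α ^ 2 + 2 * |α ^ 2 - lam| := by
    have h1 : ‖(α : ℂ) - σ * sqrtD α lam‖ ≤ |α| + ‖sqrtD α lam‖ := by
      simpa [hσn] using norm_sub_le (α : ℂ) (σ * sqrtD α lam)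
    calc _ ≤ (|α| + ‖sqrtD α lam‖) ^ 2 := by gcongr
      _ ≤ 2 * (|α| ^ 2 + ‖sqrtD α lam‖ ^ 2) := add_sq_le
      _ = _ := by rw [norm_sqrtD_sq, sq_abs]; ring
  rw [← hn, div_add' _ _ _ hpos.ne', div_mul_eq_mul_div]
  gcongr

lemma exists_pos_le_abs_sub {lam : ℕ → ℝ} (h : Tendsto lam atTop atTop) {b : ℝ}
    (hne : ∀ k, lam k ≠ b) : ∃ δ > 0, ∀ k, δ ≤ |b - lam k| := by
  have ht : Tendsto (fun k => |b - lam k|⁻¹) atTop (𝓝 0) :=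
    (tendsto_abs_atBot_atTop.comp
      (tendsto_atBot_add_const_left _ b (tendsto_neg_atTop_atBot.comp h))).inv_tendsto_atTop
  obtain ⟨M, hM⟩ := ht.bddAbove_range
  have hpos : ∀ k, 0 < |b - lam k|⁻¹ := fun k =>
    inv_pos.2 (abs_pos.2 (sub_ne_zero.2 (hne k).symm))
  have hM' : ∀ k, |b - lam k|⁻¹ ≤ M := fun k => hM ⟨k, rfl⟩
  have hM0 : 0 < M := (hpos 0).trans_le (hM' 0)
  exact ⟨M⁻¹, inv_pos.2 hM0, fun k => (inv_le_comm₀ (inv_pos.1 (hpos k)) hM0).1 (hM' k)⟩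

/-- Spectral estimate with weight `λₖ²/|α²-λₖ|`. -/
theorem spectral_estimate_AR
    (ρ : ℝ) (hρ0 : 0 < ρ) (hρ1 : ρ < 1) (μ : ℂ) (α : ℝ) (hα : 0 < α)
    (lam : ℕ → ℝ) (hlam_pos : ∀ k, 0 < lam k) (hlam_mono : Monotone lam)
    (hlam_tend : Tendsto lam atTop atTop) (hlam_ne : ∀ k, lam k ≠ α ^ 2) :
    ∃ C₆ > (0:ℝ), ∀ t : ℝ, 0 < t → ∀ g : ℕ → ℂ, Summable (fun k => ‖g k‖ ^ 2) →
      ∀ σ : ℂ, (σ = 1 ∨ σ = -1) →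
        (∑' k, (lam k ^ 2 / |α ^ 2 - lam k|) *
            ‖mlE ρ μ (-(((α : ℂ) + σ * sqrtD α (lam k))) * ((t ^ ρ : ℝ) : ℂ))‖ ^ 2 *
            ‖g k‖ ^ 2) ≤
          C₆ * t ^ (-(2 * ρ)) * ∑' k, ‖g k‖ ^ 2 := by
  obtain ⟨C, hC⟩ := exists_norm_mul_norm_mlE_le hρ0 hρ1 μ
  obtain ⟨δ, hδ0, hδ⟩ := exists_pos_le_abs_sub hlam_tend hlam_ne
  obtain ⟨D, hD⟩ : ∃ D, D = (2 * α ^ 2 / δ + 2) * (C ^ 2 + 1) := ⟨_, rfl⟩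
  have hD0 : 0 < D := by rw [hD]; positivity
  refine ⟨D, hD0, fun t ht g hg σ hσ => ?_⟩
  have hterm : ∀ k, (lam k ^ 2 / |α ^ 2 - lam k|) *
      ‖mlE ρ μ (-(((α : ℂ) + σ * sqrtD α (lam k))) * ((t ^ ρ : ℝ) : ℂ))‖ ^ 2 * ‖g k‖ ^ 2 ≤
      D * t ^ (-(2 * ρ)) * ‖g k‖ ^ 2 := fun k => by
    have hp : 0 < t ^ ρ := Real.rpow_pos_of_pos ht ρ
    have hpt : t ^ (-(2 * ρ)) = ((t ^ ρ) ^ 2)⁻¹ := by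
      rw [Real.rpow_neg ht.le, mul_comm, Real.rpow_mul ht.le]
      norm_cast
    set x : ℂ := (α : ℂ) + σ * sqrtD α (lam k)
    have hxre : 0 < x.re := re_add_mul_sqrtD_pos hα (hlam_pos k) hσ
    set y := ‖mlE ρ μ (-x * ((t ^ ρ : ℝ) : ℂ))‖
    have hb : ‖x‖ * t ^ ρ * y ≤ C := by
      have h := hC (-x * ((t ^ ρ : ℝ) : ℂ)) (by
        rw [re_mul_ofReal, neg_re]
        nlinarith)
      rwa [norm_mul, norm_neg, norm_real, Real.norm_of_nonneg hp.le] at h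
    have hb2 : (‖x‖ * t ^ ρ * y) ^ 2 ≤ C ^ 2 + 1 := by
      have : (‖x‖ * t ^ ρ * y) ^ 2 ≤ C ^ 2 := by gcongr
      linarith
    have hwt : lam k ^ 2 / |α ^ 2 - lam k| ≤ (2 * α ^ 2 / δ + 2) * ‖x‖ ^ 2 := by
      refine (weight_le (hlam_pos k) (hlam_ne k) hσ).trans ?_
      gcongr
      exact hδ k
    refine mul_le_mul_of_nonneg_right ?_ (by positivity)
    calc _ ≤ (2 * α ^ 2 / δ + 2) * ‖x‖ ^ 2 * y ^ 2 := by gcongr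
      _ = (2 * α ^ 2 / δ + 2) * (‖x‖ * t ^ ρ * y) ^ 2 * ((t ^ ρ) ^ 2)⁻¹ := by
          field_simp
      _ ≤ _ := by
          rw [hpt, hD]
          gcongr
  have hsum : Summable fun k => D * t ^ (-(2 * ρ)) * ‖g k‖ ^ 2 := hg.mul_left _
  rw [← tsum_mul_left]
  exact (Summable.of_nonneg_of_le (fun k => by positivity) hterm hsum).tsum_le_tsum hterm hsum
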